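/- For a generic symmetric n×n matrix X over a field of characteristic 0, and each k with 0 ≤ k ≤ n, the k-th component of the space of partial derivatives of perm(X) is the span of the (n−k)×(n−k) subpermanents of X; in particular its dimension (the k-th Hilbert function value of the apolar algebra of perm(X)) equals C(n,k)·(C(n,k)+1)/2. -/

import Mathlib

open MvPolynomial

/-- The permanent of the generic symmetric `n × n` matrix. -/
noncomputable def symPerm (K : Type*) [Field K] (n : ℕ) : MvPolynomial (Sym2 (Fin n)) K :=
  ∑ σ : Equiv.Perm (Fin n), ∏ i : Fin n, X s(i, σ i)

/-- The span of the `k`-th order partial derivatives of `symPerm K n`. -/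
noncomputable def derivSpace (K : Type*) [Field K] (n k : ℕ) :
    Submodule K (MvPolynomial (Sym2 (Fin n)) K) :=
  Submodule.span K
    {p | ∃ L : List (Sym2 (Fin n)), L.length = k ∧
      p = L.foldr (fun s q => pderiv s q) (symPerm K n)}

section SubpermanentSpace

open Finset

/-- The monomial `∏ x_{ij}` over the pairs `(i, j)` of `μ`. -/
noncomputable def edgeMonomial (K : Type*) {α : Type*} [Field K] (μ : Finset (α × α)) :
    MvPolynomial (Sym2 α) K :=
  ∏ e ∈ μ, X s(e.1, e.2)

lemma pderiv_edgeMonomial {K α : Type*} [Field K] [DecidableEq α]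
    (s : Sym2 α) (μ : Finset (α × α)) :
    pderiv s (edgeMonomial K μ) = ∑ e ∈ μ with s(e.1, e.2) = s, edgeMonomial K (μ.erase e) := by
  unfold edgeMonomial
  induction μ using Finset.induction_on with
  | empty => simp
  | insert a μ ha ih =>
    rw [prod_insert ha, Derivation.leibniz, ih, filter_insert]
    have key : ∑ e ∈ μ with s(e.1, e.2) = s,
        ∏ e ∈ (insert a μ).erase e, (X s(e.1, e.2) : MvPolynomial (Sym2 α) K) =
        X s(a.1, a.2) * ∑ e ∈ μ with s(e.1, e.2) = s, ∏ e ∈ μ.erase e, X s(e.1, e.2) := by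
      rw [mul_sum]
      refine sum_congr rfl fun e he => ?_
      have hea : a ≠ e := by rintro rfl; exact ha (mem_filter.1 he).1
      rw [erase_insert_of_ne hea, prod_insert (fun h => ha (mem_of_mem_erase h))]
    split_ifs with h
    · rw [sum_insert (by simp [ha]), key, erase_insert ha, h, pderiv_X_self]
      simp [add_comm]
    · rw [key, pderiv_X_of_ne h]
      simp

variable {K α : Type*} [Field K] [Fintype α] [DecidableEq α]

/-- `μ` is the graph of a partial injection of `α` whose domain avoids `U` and whose range
avoids `V`. -/
def IsPartialMatching (U V : Finset α) (μ : Finset (α × α)) : Prop :=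
  (∀ e ∈ μ, ∀ e' ∈ μ, e.1 = e'.1 → e = e') ∧ (∀ e ∈ μ, ∀ e' ∈ μ, e.2 = e'.2 → e = e') ∧
    ∀ e ∈ μ, e.1 ∉ U ∧ e.2 ∉ V

noncomputable instance (U V : Finset α) : DecidablePred (IsPartialMatching U V) :=
  Classical.decPred _

variable (K) in
/-- The subpermanent of the generic symmetric matrix with rows `I` and columns `J`. -/
noncomputable def subPerm (I J : Finset α) : MvPolynomial (Sym2 α) K :=
  ∑ μ : Finset (α × α) with IsPartialMatching ∅ ∅ μ ∧ μ.image Prod.fst = I ∧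
    μ.image Prod.snd = J, edgeMonomial K μ

/-- The combination of the subpermanents with rows `I \ U` and columns `J \ V`, with weights
`b I J`, over all `I ⊇ U` and `J ⊇ V`. -/
noncomputable def weightedPerm (b : Finset α → Finset α → K) (U V : Finset α) :
    MvPolynomial (Sym2 α) K :=
  ∑ μ : Finset (α × α) with IsPartialMatching U V μ,
    b (U ∪ μ.image Prod.fst) (V ∪ μ.image Prod.snd) • edgeMonomial K μ

lemma pderiv_weightedPerm (b : Finset α → Finset α → K) (s : Sym2 α) (U V : Finset α) :
    pderiv s (weightedPerm b U V) = ∑ e : α × α with s(e.1, e.2) = s ∧ e.1 ∉ U ∧ e.2 ∉ V,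
      weightedPerm b (insert e.1 U) (insert e.2 V) := by
  unfold weightedPerm
  simp only [map_sum, Derivation.map_smul, pderiv_edgeMonomial, smul_sum]
  rw [sum_sigma', sum_sigma']
  refine sum_bij' (fun x _ => ⟨x.2, x.1.erase x.2⟩) (fun y _ => ⟨insert y.1 y.2, y.1⟩)
    ?_ ?_ ?_ ?_ ?_
  · rintro ⟨μ, e⟩ h
    simp only [mem_sigma, mem_filter, mem_univ, true_and, IsPartialMatching, mem_insert] at h ⊢
    grind
  · rintro ⟨e, μ⟩ h
    simp only [mem_sigma, mem_filter, mem_univ, true_and, IsPartialMatching, mem_insert] at h ⊢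
    grind
  · rintro ⟨μ, e⟩ h
    simp only [mem_sigma, mem_filter] at h
    simp [insert_erase h.2.1]
  · rintro ⟨e, μ⟩ h
    simp only [mem_sigma, mem_filter, mem_univ, true_and, IsPartialMatching, mem_insert] at h
    have : e ∉ μ := by grind
    simp [erase_insert this]
  · rintro ⟨μ, e⟩ h
    simp only [mem_sigma, mem_filter] at h
    obtain ⟨ν, hν, rfl⟩ : ∃ ν, e ∉ ν ∧ μ = insert e ν :=
      ⟨μ.erase e, by simp, (insert_erase h.2.1).symm⟩
    simp only [erase_insert hν, image_insert, union_insert, insert_union]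

lemma weightedPerm_swap (b : Finset α → Finset α → K) (U V : Finset α) :
    weightedPerm b U V = weightedPerm (fun I J => b J I) V U := by
  unfold weightedPerm
  have hinv : ∀ μ : Finset (α × α), (μ.image Prod.swap).image Prod.swap = μ := fun μ => by
    simp [image_image]
  have hmem : ∀ (U V : Finset α) (μ : Finset (α × α)), μ ∈ univ.filter (IsPartialMatching U V) →
      μ.image Prod.swap ∈ univ.filter (IsPartialMatching V U) := by
    intro U V μ h
    simp only [mem_filter, mem_univ, true_and, IsPartialMatching, forall_mem_image] at h ⊢
    refine ⟨fun e he e' he' hee => ?_, fun e he e' he' hee => ?_, fun e he => ?_⟩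
    · rw [h.2.1 e he e' he' hee]
    · rw [h.1 e he e' he' hee]
    · exact (h.2.2 e he).symm
  refine sum_bij' (fun μ _ => μ.image Prod.swap) (fun μ _ => μ.image Prod.swap)
    (fun μ => hmem U V μ) (fun μ => hmem V U μ) (fun μ _ => hinv μ) (fun μ _ => hinv μ)
    fun μ _ => ?_
  have h1 : (μ.image Prod.swap).image Prod.fst = μ.image Prod.snd := by
    rw [image_image]; rfl
  have h2 : (μ.image Prod.swap).image Prod.snd = μ.image Prod.fst := by
    rw [image_image]; rfl
  rw [h1, h2]
  congr 1
  unfold edgeMonomial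
  rw [prod_image Prod.swap_injective.injOn]
  exact prod_congr rfl fun e _ => by rw [Sym2.eq_swap]; rfl

lemma weightedPerm_comm {b : Finset α → Finset α → K} (hb : ∀ I J, b I J = b J I)
    (U V : Finset α) : weightedPerm b U V = weightedPerm b V U := by
  rw [weightedPerm_swap]
  simp only [← hb]

end SubpermanentSpace

/-- The span of the `k`-th order partial derivatives of `p`. -/
noncomputable def partialsSpan {σ K : Type*} [Field K] (p : MvPolynomial σ K) (k : ℕ) :
    Submodule K (MvPolynomial σ K) :=
  Submodule.span K {q | ∃ L : List σ, L.length = k ∧ q = L.foldr (fun s r => pderiv s r) p}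

lemma self_mem_partialsSpan {σ K : Type*} [Field K] (p : MvPolynomial σ K) :
    p ∈ partialsSpan p 0 :=
  Submodule.subset_span ⟨[], rfl, rfl⟩

lemma pderiv_mem_partialsSpan {σ K : Type*} [Field K] {p q : MvPolynomial σ K} {k : ℕ}
    (hq : q ∈ partialsSpan p k) (s : σ) : pderiv s q ∈ partialsSpan p (k + 1) := by
  have : partialsSpan p k ≤ (partialsSpan p (k + 1)).comap (pderiv s).toLinearMap := by
    refine Submodule.span_le.2 ?_
    rintro _ ⟨L, hL, rfl⟩
    exact Submodule.subset_span ⟨s :: L, by simp [hL], rfl⟩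
  exact this hq

lemma partialsSpan_zero {σ K : Type*} [Field K] (k : ℕ) :
    partialsSpan (0 : MvPolynomial σ K) k = ⊥ := by
  refine (Submodule.eq_bot_iff _).2 fun x hx => ?_
  refine (Submodule.span_le (p := ⊥)).2 ?_ hx
  rintro _ ⟨L, -, rfl⟩
  have : L.foldr (fun s r => pderiv s r) (0 : MvPolynomial σ K) = 0 := by
    induction L with
    | nil => rfl
    | cons s L ih => simp [ih]
  simp [this]

section

open Finset

variable {K α : Type*} [Field K] [Fintype α] [DecidableEq α]

lemma pderiv_weightedPerm_diag (b : Finset α → Finset α → K) {A : Finset α} {p : α}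
    (hp : p ∉ A) :
    pderiv s(p, p) (weightedPerm b A A) = weightedPerm b (insert p A) (insert p A) := by
  rw [pderiv_weightedPerm]
  have : (univ.filter fun e : α × α => s(e.1, e.2) = s(p, p) ∧ e.1 ∉ A ∧ e.2 ∉ A) =
      {(p, p)} := by
    ext ⟨x, y⟩
    simp only [mem_filter, mem_univ, true_and, Sym2.eq_iff, mem_singleton, Prod.mk.injEq]
    grind
  rw [this, sum_singleton]

lemma pderiv_weightedPerm_of_ne (b : Finset α → Finset α → K) {U V : Finset α} {p q : α}
    (hpq : p ≠ q) (hpU : p ∉ U) (hpV : p ∉ V) (hqU : q ∉ U) (hqV : q ∉ V) :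
    pderiv s(p, q) (weightedPerm b U V) =
      weightedPerm b (insert p U) (insert q V) + weightedPerm b (insert q U) (insert p V) := by
  rw [pderiv_weightedPerm]
  have : (univ.filter fun e : α × α => s(e.1, e.2) = s(p, q) ∧ e.1 ∉ U ∧ e.2 ∉ V) =
      {(p, q), (q, p)} := by
    ext ⟨x, y⟩
    simp only [mem_filter, mem_univ, true_and, Sym2.eq_iff, mem_insert, mem_singleton,
      Prod.mk.injEq]
    grind
  rw [this, sum_pair (by simp [hpq])]

lemma weightedPerm_self_mem (b : Finset α → Finset α → K) (A : Finset α) :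
    weightedPerm b A A ∈ partialsSpan (weightedPerm b ∅ ∅) #A := by
  induction A using Finset.induction_on with
  | empty => exact self_mem_partialsSpan _
  | insert p A hp ih =>
    rw [card_insert_of_notMem hp, ← pderiv_weightedPerm_diag b hp]
    exact pderiv_mem_partialsSpan ih _

lemma sdiff_insert_subset_erase {α : Type*} [DecidableEq α] {U W : Finset α} {p q q' x : α}
    (hp : p ∉ U) (hq : q ∉ U) (hq' : q' ∉ U) :
    U \ insert x W ⊆ (insert p U \ insert q (insert q' W)).erase p := by
  intro y
  simp only [mem_sdiff, mem_insert, mem_erase]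
  grind

/-- If `b` is symmetric, every `weightedPerm b I J` with `|I| = |J|` is a combination of
partial derivatives of order `|I|` of `weightedPerm b ∅ ∅`. -/
lemma weightedPerm_mem [CharZero K] {b : Finset α → Finset α → K} (hb : ∀ I J, b I J = b J I)
    {I J : Finset α} (hIJ : #I = #J) :
    weightedPerm b I J ∈ partialsSpan (weightedPerm b ∅ ∅) #I := by
  obtain ⟨r, hr⟩ : ∃ r, #(I \ J) = r := ⟨_, rfl⟩
  induction r using Nat.strong_induction_on generalizing I J with
  | _ r ih =>
    have hr' : #(J \ I) = r := by rw [← hr, card_sdiff_comm hIJ]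
    have step : ∀ U V p q, p ∉ U → p ∉ V → q ∉ U → q ∉ V → p ≠ q → #U = #V →
        #U + 1 = #I → #(U \ V) < r →
        weightedPerm b (insert p U) (insert q V) + weightedPerm b (insert q U) (insert p V) ∈
          partialsSpan (weightedPerm b ∅ ∅) #I := by
      intro U V p q hpU hpV hqU hqV hpq hUV hU hlt
      rw [← pderiv_weightedPerm_of_ne b hpq hpU hpV hqU hqV, ← hU]
      exact pderiv_mem_partialsSpan (ih _ hlt hUV rfl) _
    have half : ∀ x : MvPolynomial (Sym2 α) K, x + x ∈ partialsSpan (weightedPerm b ∅ ∅) #I →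
        x ∈ partialsSpan (weightedPerm b ∅ ∅) #I := by
      intro x hx
      have := Submodule.smul_mem _ (2⁻¹ : K) hx
      rwa [← two_smul K x, smul_smul, inv_mul_cancel₀ two_ne_zero, one_smul] at this
    rcases Nat.eq_zero_or_pos r with rfl | hpos
    · have h1 : I ⊆ J := sdiff_eq_empty_iff_subset.1 (card_eq_zero.1 hr)
      obtain rfl := eq_of_subset_of_card_le h1 hIJ.ge
      exact weightedPerm_self_mem b I
    obtain ⟨p, hp⟩ := card_pos.1 (hr ▸ hpos)
    obtain ⟨q, hq⟩ := card_pos.1 (hr' ▸ hpos)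
    rw [mem_sdiff] at hp hq
    have hpq : p ≠ q := fun h => hp.2 (h ▸ hq.1)
    have hpI := card_erase_add_one hp.1
    have hqJ := card_erase_add_one hq.1
    have hcard : #((I \ J).erase p) + 1 = r := by
      rw [card_erase_add_one (mem_sdiff.2 hp), hr]
    clear ih
    rcases Nat.lt_or_ge 1 r with h2 | h2
    · obtain ⟨q', hq', hqq'⟩ : ∃ q' ∈ J \ I, q' ≠ q := exists_mem_ne (hr' ▸ h2) q
      rw [mem_sdiff] at hq'
      have hpq' : p ≠ q' := fun h => hp.2 (h ▸ hq'.1)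
      obtain ⟨U, hpU, rfl⟩ : ∃ U, p ∉ U ∧ I = insert p U :=
        ⟨I.erase p, by simp, (insert_erase hp.1).symm⟩
      obtain ⟨W, hqW, hqW', rfl⟩ : ∃ W, q ∉ W ∧ q' ∉ W ∧ J = insert q (insert q' W) :=
        ⟨(J.erase q).erase q', by simp, by simp, by
          rw [insert_erase (mem_erase.2 ⟨hqq', hq'.1⟩), insert_erase hq.1]⟩
      simp only [mem_insert, not_or] at hp hq hq'
      have hI : #U + 1 = #(insert p U) := (card_insert_of_notMem hpU).symm
      have hUW : #U = #W + 1 := by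
        rw [← hI, card_insert_of_notMem (by simp [hqq'.symm, hqW]),
          card_insert_of_notMem hqW'] at hIJ
        omega
      have key : ∀ x y z, x ∉ W → y ∉ U → z ∉ U → y ∉ W → z ∉ W → x ≠ y → x ≠ z → y ≠ z →
          weightedPerm b (insert y U) (insert z (insert x W)) +
            weightedPerm b (insert z U) (insert y (insert x W)) ∈
          partialsSpan (weightedPerm b ∅ ∅) #(insert p U) := by
        intro x y z hxW hyU hzU hyW hzW hxy hxz hyz
        refine step U (insert x W) y z hyU (by simp [hxy.symm, hyW]) hzU
          (by simp [hxz.symm, hzW]) hyz (by rw [card_insert_of_notMem hxW, hUW]) hI ?_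
        have := card_le_card (sdiff_insert_subset_erase (W := W) (x := x) hpU hq.2.2 hq'.2.2)
        omega
      have e1 := key q' p q hqW' hpU hq.2.2 hp.2.2.2 hqW hpq'.symm hqq' hpq
      have e2 := key p q q' hp.2.2.2 hq.2.2 hq'.2.2 hqW hqW' hpq hpq' hqq'.symm
      have e3 := key q q' p hqW hq'.2.2 hpU hqW' hp.2.2.2 hqq'.symm hpq.symm hpq'.symm
      refine half _ ?_
      have := Submodule.add_mem _ (Submodule.sub_mem _ e1 e2) e3
      rw [insert_comm p q' W, insert_comm q p W, insert_comm p q W, insert_comm q' q W] at this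
      convert this using 1
      abel
    · obtain rfl : r = 1 := by omega
      have hU : I.erase p = J.erase q := by
        have h1 : I.erase p ⊆ J := by
          rw [← sdiff_eq_empty_iff_subset, erase_sdiff_comm, ← card_eq_zero]; omega
        exact eq_of_subset_of_card_le (fun x hx => mem_erase.2
          ⟨fun h => hq.2 (h ▸ mem_of_mem_erase hx), h1 hx⟩) (by omega)
      have := step (I.erase p) (J.erase q) p q (by simp) (by simp [hp.2]) (by simp [hq.2])
        (by simp) hpq (by omega) hpI (by simp [hU])
      rw [weightedPerm_comm hb (insert q _) _, ← hU, insert_erase hp.1, hU,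
        insert_erase hq.1] at this
      exact half _ this

end

section

open Finset

variable {K α : Type*} [Field K] [Fintype α] [DecidableEq α]

lemma weightedPerm_empty (b : Finset α → Finset α → K) :
    weightedPerm b ∅ ∅ = ∑ x : Finset α × Finset α, b x.1 x.2 • subPerm K x.1 x.2 := by
  unfold weightedPerm subPerm
  rw [← sum_fiberwise _ fun μ : Finset (α × α) => (μ.image Prod.fst, μ.image Prod.snd)]
  refine sum_congr rfl fun x _ => ?_
  rw [smul_sum, filter_filter]
  refine sum_congr (by ext μ; simp [Prod.ext_iff]) fun μ hμ => ?_
  obtain ⟨-, -, h1, h2⟩ := mem_filter.1 hμ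
  simp [h1, h2]

lemma subPerm_comm (I J : Finset α) : subPerm K I J = subPerm K J I := by
  have key : ∀ I J : Finset α, subPerm K I J =
      weightedPerm (fun X Y => if (X, Y) = (I, J) then (1 : K) else 0) ∅ ∅ := fun I J => by
    rw [weightedPerm_empty, sum_eq_single_of_mem (I, J) (mem_univ _)]
    · simp
    · intro x _ hx
      rw [if_neg hx, zero_smul]
  rw [key, key, weightedPerm_swap]
  simp only [Prod.mk.injEq, and_comm]

lemma weightedPerm_of_card {b : Finset α → Finset α → K} {I J : Finset α}
    (hb : ∀ X Y, b X Y ≠ 0 → #X = #I) : weightedPerm b I J = C (b I J) := by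
  unfold weightedPerm
  rw [sum_eq_single_of_mem ∅ (mem_filter.2 ⟨mem_univ _, by simp [IsPartialMatching]⟩)]
  · simp [edgeMonomial, MvPolynomial.smul_eq_C_mul]
  · intro μ hμ hne
    obtain ⟨e, he⟩ := nonempty_iff_ne_empty.2 hne
    have hlt : #I < #(I ∪ μ.image Prod.fst) :=
      card_lt_card ((ssubset_iff_of_subset subset_union_left).2
        ⟨e.1, mem_union_right _ (mem_image_of_mem _ he), ((mem_filter.1 hμ).2.2.2 e he).1⟩)
    by_cases h : b (I ∪ μ.image Prod.fst) (J ∪ μ.image Prod.snd) = 0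
    · rw [h, zero_smul]
    · exact absurd (hb _ _ h) hlt.ne'

lemma weightedPerm_univ (U V : Finset α) :
    weightedPerm (fun X Y => if X = univ ∧ Y = univ then (1 : K) else 0) U V =
      subPerm K Uᶜ Vᶜ := by
  unfold weightedPerm subPerm
  simp only [ite_smul, one_smul, zero_smul]
  rw [← sum_filter, filter_filter]
  refine sum_congr (filter_congr fun μ _ => ?_) fun _ _ => rfl
  have h : ∀ W T : Finset α, ((∀ x ∈ T, x ∉ W) ∧ W ∪ T = univ) ↔ T = Wᶜ := by
    intro W T
    constructor
    · rintro ⟨h1, h2⟩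
      ext x
      have := h2 ▸ mem_univ x
      simp only [mem_union, mem_compl] at this ⊢
      exact ⟨h1 x, this.resolve_left⟩
    · rintro rfl
      simp
  rw [← h, ← h, forall_mem_image, forall_mem_image]
  simp only [IsPartialMatching, notMem_empty, not_false_eq_true, and_self, implies_true, and_true]
  constructor
  · rintro ⟨⟨h1, h2, h3⟩, h4, h5⟩
    exact ⟨⟨h1, h2⟩, ⟨fun _ he => (h3 _ he).1, h4⟩, fun _ he => (h3 _ he).2, h5⟩
  · rintro ⟨⟨h1, h2⟩, ⟨h3, h4⟩, h5, h6⟩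
    exact ⟨⟨h1, h2, fun _ he => ⟨h3 he, h5 he⟩⟩, h4, h6⟩

lemma sum_perm_eq_subPerm {ι : Type*} [Fintype ι] [DecidableEq ι] (f g : ι ↪ α) :
    ∑ σ : Equiv.Perm ι, ∏ i, (X s(f i, g (σ i)) : MvPolynomial (Sym2 α) K) =
      subPerm K (univ.map f) (univ.map g) := by
  unfold subPerm
  refine sum_bij (fun σ _ => univ.image fun i => (f i, g (σ i))) ?_ ?_ ?_ ?_
  · intro σ _
    rw [mem_filter]
    simp only [mem_univ, true_and, IsPartialMatching, forall_mem_image, image_image]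
    refine ⟨⟨?_, ?_, by simp⟩, ?_, ?_⟩
    · intro i _ j _ h
      rw [f.injective h]
    · intro i _ j _ h
      rw [σ.injective (g.injective h)]
    · rw [map_eq_image]; rfl
    · rw [map_eq_image]
      conv_rhs => rw [← image_univ_equiv σ, image_image]
      rfl
  · intro σ _ τ _ h
    ext i
    have : (f i, g (σ i)) ∈ univ.image fun i => (f i, g (τ i)) :=
      h ▸ mem_image_of_mem _ (mem_univ i)
    obtain ⟨j, -, hj⟩ := mem_image.1 this
    obtain rfl := f.injective (Prod.ext_iff.1 hj).1
    exact (g.injective (Prod.ext_iff.1 hj).2).symm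
  · intro μ hμ
    obtain ⟨-, ⟨h1, h2, -⟩, hI, hJ⟩ := mem_filter.1 hμ
    have hex : ∀ i, ∃ j, (f i, g j) ∈ μ := by
      intro i
      have hi : f i ∈ μ.image Prod.fst := hI ▸ mem_map_of_mem f (mem_univ i)
      obtain ⟨⟨x, y⟩, he, rfl⟩ := mem_image.1 hi
      have hy : y ∈ univ.map g := hJ ▸ mem_image_of_mem Prod.snd he
      obtain ⟨j, -, rfl⟩ := mem_map.1 hy
      exact ⟨j, he⟩
    choose τ hτ using hex
    have hinj : Function.Injective τ := fun i j hij =>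
      f.injective (Prod.ext_iff.1 (h2 _ (hτ i) _ (hτ j) (by simp [hij]))).1
    refine ⟨Equiv.ofBijective τ (Finite.injective_iff_bijective.1 hinj), mem_univ _, ?_⟩
    ext e
    simp only [mem_image, mem_univ, true_and, Equiv.ofBijective_apply]
    constructor
    · rintro ⟨i, rfl⟩
      exact hτ i
    · intro he
      have hx : e.1 ∈ univ.map f := hI ▸ mem_image_of_mem Prod.fst he
      obtain ⟨i, -, hi⟩ := mem_map.1 hx
      exact ⟨i, h1 _ (hτ i) _ he hi⟩
  · intro σ _
    unfold edgeMonomial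
    rw [prod_image]
    intro i _ j _ h
    exact f.injective (Prod.ext_iff.1 h).1

variable (K α) in
/-- The family of subpermanents of size `m`, indexed by unordered pairs `{I, J}`. -/
noncomputable def subPermFamily (m : ℕ) (z : Sym2 {I : Finset α // #I = m}) :
    MvPolynomial (Sym2 α) K :=
  Sym2.lift ⟨fun I J : {I : Finset α // #I = m} => subPerm K (I : Finset α) (J : Finset α),
    fun _ _ => subPerm_comm _ _⟩ z

lemma linearIndependent_subPermFamily [CharZero K] (m : ℕ) :
    LinearIndependent K (subPermFamily K α m) := by
  rw [Fintype.linearIndependent_iff]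
  intro a ha
  let S := {I : Finset α // #I = m}
  let N : Sym2 S → ℕ := fun z => #{x : S × S | s(x.1, x.2) = z}
  have hN : ∀ z, (N z : K) ≠ 0 := by
    refine fun z => Nat.cast_ne_zero.2 (card_pos.2 ?_).ne'
    induction z with
    | _ I J => exact ⟨(I, J), by simp⟩
  let b : Finset α → Finset α → K := fun I J =>
    if h : #I = m ∧ #J = m then
      a s(⟨I, h.1⟩, ⟨J, h.2⟩) / N s(⟨I, h.1⟩, ⟨J, h.2⟩) else 0
  have hbS : ∀ I J : S, b I J = a s(I, J) / N s(I, J) := fun I J => dif_pos ⟨I.2, J.2⟩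
  have hb : ∀ I J, b I J = b J I := by
    intro I J
    by_cases h : #I = m ∧ #J = m
    · rw [hbS ⟨I, h.1⟩ ⟨J, h.2⟩, Sym2.eq_swap]
      exact (hbS ⟨J, h.2⟩ ⟨I, h.1⟩).symm
    · have h' : ¬(#J = m ∧ #I = m) := mt And.symm h
      rw [show b I J = 0 from dif_neg h, show b J I = 0 from dif_neg h']
  have hzero : weightedPerm b ∅ ∅ = 0 := by
    rw [weightedPerm_empty, ← ha]
    have hinj : Function.Injective
        (fun x : S × S => ((x.1 : Finset α), (x.2 : Finset α))) := fun x y h =>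
      Prod.ext (Subtype.ext (Prod.ext_iff.1 h).1) (Subtype.ext (Prod.ext_iff.1 h).2)
    rw [← Finset.sum_subset (subset_univ (univ.map ⟨_, hinj⟩)), sum_map]
    · rw [← sum_fiberwise _ fun x : S × S => s(x.1, x.2)]
      refine sum_congr rfl fun z _ => ?_
      have : ∀ x ∈ univ.filter (fun x : S × S => s(x.1, x.2) = z),
          b x.1 x.2 • subPerm K (x.1 : Finset α) (x.2 : Finset α) =
            (a z / N z) • subPermFamily K α m z := by
        intro x hx
        obtain rfl := (mem_filter.1 hx).2
        rw [hbS]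
        rfl
      rw [Function.Embedding.coeFn_mk, sum_congr rfl this, sum_const, ← Nat.cast_smul_eq_nsmul K,
        smul_smul]
      exact congrArg (· • _) (mul_div_cancel₀ _ (hN z))
    · rintro ⟨I, J⟩ - h
      have : ¬(#I = m ∧ #J = m) := fun hc =>
        h (mem_map.2 ⟨(⟨I, hc.1⟩, ⟨J, hc.2⟩), mem_univ _, rfl⟩)
      rw [show b I J = 0 from dif_neg this, zero_smul]
  intro z
  induction z with
  | _ I J =>
    have hmem := weightedPerm_mem hb (I.2.trans J.2.symm)
    have hcard : ∀ X Y, b X Y ≠ 0 → #X = #(I : Finset α) := by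
      intro X Y h
      by_contra hX
      exact h (dif_neg fun hc => hX (hc.1.trans I.2.symm))
    rw [hzero, partialsSpan_zero, Submodule.mem_bot, weightedPerm_of_card hcard,
      map_eq_zero_iff _ (C_injective _ _), hbS, div_eq_zero_iff] at hmem
    exact hmem.resolve_right (hN _)

lemma partialsSpan_subPerm_univ_le {k : ℕ} :
    partialsSpan (subPerm K (univ : Finset α) univ) k ≤
      Submodule.span K {p | ∃ U V : Finset α, #U = k ∧ #V = k ∧ p = subPerm K Uᶜ Vᶜ} := by
  refine Submodule.span_le.2 ?_
  rintro _ ⟨L, rfl, rfl⟩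
  induction L with
  | nil => exact Submodule.subset_span ⟨∅, ∅, rfl, rfl, by simp⟩
  | cons s L ih =>
    rw [List.foldr_cons]
    refine (Submodule.span_le (p := (Submodule.span K {p | ∃ U V : Finset α,
      #U = (s :: L).length ∧ #V = (s :: L).length ∧ p = subPerm K Uᶜ Vᶜ}).comap
        (pderiv s).toLinearMap)).2 ?_ ih
    rintro _ ⟨U, V, hU, hV, rfl⟩
    rw [← weightedPerm_univ]
    change pderiv s (weightedPerm (K := K) _ U V) ∈ Submodule.span K _
    rw [pderiv_weightedPerm]
    refine Submodule.sum_mem _ fun e he => Submodule.subset_span ?_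
    obtain ⟨-, -, h1, h2⟩ := mem_filter.1 he
    exact ⟨_, _, by rw [card_insert_of_notMem h1, hU, List.length_cons],
      by rw [card_insert_of_notMem h2, hV, List.length_cons], weightedPerm_univ _ _⟩

lemma partialsSpan_subPerm_univ [CharZero K] (k : ℕ) :
    partialsSpan (subPerm K (univ : Finset α) univ) k =
      Submodule.span K {p | ∃ U V : Finset α, #U = k ∧ #V = k ∧ p = subPerm K Uᶜ Vᶜ} := by
  refine le_antisymm partialsSpan_subPerm_univ_le (Submodule.span_le.2 ?_)
  rintro _ ⟨U, V, rfl, hV, rfl⟩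
  have := weightedPerm_mem (K := K)
    (b := fun X Y : Finset α => if X = univ ∧ Y = univ then (1 : K) else 0)
    (fun I J => by simp only [and_comm]) hV.symm
  rwa [weightedPerm_univ, weightedPerm_univ, compl_empty] at this

end

lemma symPerm_eq_subPerm (K : Type*) [Field K] (n : ℕ) :
    symPerm K n = subPerm K Finset.univ Finset.univ := by
  have := sum_perm_eq_subPerm (K := K) (Function.Embedding.refl (Fin n)) (.refl _)
  rwa [Finset.map_refl] at this

lemma derivSpace_eq_span_range {K : Type*} [Field K] [CharZero K] {n k : ℕ} (hk : k ≤ n) :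
    derivSpace K n k = Submodule.span K (Set.range (subPermFamily K (Fin n) (n - k))) := by
  change partialsSpan (symPerm K n) k = _
  rw [symPerm_eq_subPerm, partialsSpan_subPerm_univ]
  congr 1
  ext p
  constructor
  · rintro ⟨U, V, hU, hV, rfl⟩
    exact ⟨s(⟨Uᶜ, by simp [Finset.card_compl, hU]⟩, ⟨Vᶜ, by simp [Finset.card_compl, hV]⟩), rfl⟩
  · rintro ⟨z, rfl⟩
    induction z with
    | _ I J =>
      refine ⟨(I : Finset (Fin n))ᶜ, (J : Finset (Fin n))ᶜ, ?_, ?_, by simp [subPermFamily]⟩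
      · simp [Finset.card_compl, I.2, Nat.sub_sub_self hk]
      · simp [Finset.card_compl, J.2, Nat.sub_sub_self hk]

/-- For `0 ≤ k ≤ n`, the space of `k`-th order partial derivatives of the permanent of
the generic symmetric `n × n` matrix is spanned by the `(n−k) × (n−k)` subpermanents,
and its dimension equals `C(n,k)·(C(n,k)+1)/2`. -/
theorem derivSpace_perm_eq_subpermanents {K : Type*} [Field K] [CharZero K]
    (n k : ℕ) (hk : k ≤ n) :
    derivSpace K n k = Submodule.span K
      {p | ∃ f g : Fin (n - k) ↪ Fin n,
        p = ∑ σ : Equiv.Perm (Fin (n - k)), ∏ i : Fin (n - k),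
          (X s(f i, g (σ i)) : MvPolynomial (Sym2 (Fin n)) K)}
    ∧ Module.finrank K (derivSpace K n k) = n.choose k * (n.choose k + 1) / 2 := by
  refine ⟨?_, ?_⟩
  · rw [derivSpace_eq_span_range hk]
    congr 1
    ext p
    constructor
    · rintro ⟨z, rfl⟩
      induction z with
      | _ I J =>
        refine ⟨(I.1.orderEmbOfFin I.2).toEmbedding, (J.1.orderEmbOfFin J.2).toEmbedding, ?_⟩
        rw [sum_perm_eq_subPerm, Finset.map_orderEmbOfFin_univ, Finset.map_orderEmbOfFin_univ]
        rfl
    · rintro ⟨f, g, rfl⟩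
      refine ⟨s(⟨Finset.univ.map f, by simp⟩, ⟨Finset.univ.map g, by simp⟩), ?_⟩
      rw [sum_perm_eq_subPerm]
      rfl
  · rw [derivSpace_eq_span_range hk,
      finrank_span_eq_card (linearIndependent_subPermFamily (n - k)), Sym2.card,
      Fintype.card_finset_len, Fintype.card_fin, Nat.choose_symm hk, Nat.choose_two_right,
      Nat.add_sub_cancel, mul_comm]
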